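/- Let Λ ⊆ ℂ be a lattice, let s ∈ ℂ satisfy ns ∉ Λ for every integer n ≥ 1, let R be a pinning, and let f be an elliptic function for Λ. For r ∈ R and k ≥ 1 define φ_{r,k}(z) := ((−1)^{k−1}/(k−1)!)·ζ_Λ^{(k−1)}(z−r) for k ≥ 2 and φ_{r,1}(z) := ζ_Λ(z−r) − ζ_Λ(z). Then the reduced form f̄(z) := c₀_R(f) + pano_R(f,1)·(ζ_Λ(z−s) − ζ_Λ(z)) + Σ_{r∈R} Σ_{k≥1} ores(f,r,k)·φ_{r,k}(z) (a sum with finitely many nonzero terms) has the property that f̄ − f is elliptically summable. -/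

import Mathlib

open Filter Topology Set

/-- The Weierstrass zeta function of a lattice `L ⊆ ℂ`. -/
noncomputable def wzeta (L : Set ℂ) (z : ℂ) : ℂ :=
  1 / z + ∑' l : ↥(L \ {0}), (1 / (z - (l : ℂ)) + 1 / (l : ℂ) + z / (l : ℂ) ^ 2)

/-- `L` is a lattice in `ℂ`. -/
def IsLattice (L : Set ℂ) : Prop :=
  ∃ ω₁ ω₂ : ℂ, LinearIndependent ℝ ![ω₁, ω₂] ∧
    L = {z : ℂ | ∃ m n : ℤ, z = (m : ℂ) * ω₁ + (n : ℂ) * ω₂}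

/-- `F` extends analytically to the point `α`. -/
def ExtAnalyticAt (F : ℂ → ℂ) (α : ℂ) : Prop :=
  ∃ g : ℂ → ℂ, AnalyticAt ℂ g α ∧ ∀ᶠ z in 𝓝[≠] α, F z = g z

/-- `f` is an elliptic function for the lattice `L`: meromorphic on `ℂ` and `L`-periodic. -/
def IsElliptic (L : Set ℂ) (f : ℂ → ℂ) : Prop :=
  MeromorphicOn f Set.univ ∧
    ∀ lam ∈ L, ∀ z : ℂ, AnalyticAt ℂ f z → f (z + lam) = f z

/-- `c : ℕ → ℂ` is the family of principal part coefficients of `f` at `α`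
(`c k` is the coefficient of `1/(z-α)^k`; `c 0` is irrelevant and set to `0`). -/
def IsPrincPart (f : ℂ → ℂ) (α : ℂ) (c : ℕ → ℂ) : Prop :=
  c 0 = 0 ∧ (Function.support c).Finite ∧
    ExtAnalyticAt (fun z => f z - ∑ᶠ k : ℕ, c k / (z - α) ^ k) α

/-- `R` is a pinning: `(r, n, λ) ↦ r + n s + λ` is a bijection from `R × ℤ × L` onto `ℂ`. -/
def IsPinning (L : Set ℂ) (s : ℂ) (R : Set ℂ) : Prop :=
  ∀ z : ℂ, ∃! p : ℂ × ℤ × ℂ, p.1 ∈ R ∧ p.2.2 ∈ L ∧ z = p.1 + (p.2.1 : ℂ) * s + p.2.2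


/-- `f` is elliptically summable: `f = τ(g) − g` for some elliptic `g`,
where `τ(g)(z) = g(z+s)`. -/
def EllSummable (L : Set ℂ) (s : ℂ) (f : ℂ → ℂ) : Prop :=
  ∃ g : ℂ → ℂ, IsElliptic L g ∧
    ∀ z : ℂ, AnalyticAt ℂ g z → AnalyticAt ℂ g (z + s) → f z = g (z + s) - g z

/-- The part of the Weierstrass zeta function that is regular at the origin. -/
noncomputable def zetaReg (P : PeriodPair) (z : ℂ) : ℂ :=
  ∑' l : P.lattice, if l.1 = 0 then 0 else (1 / (z - l) + 1 / l + z / (l : ℂ) ^ 2)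

lemma IsLattice.exists_periodPair {L : Set ℂ} (hL : IsLattice L) :
    ∃ P : PeriodPair, L = (P.lattice : Set ℂ) := by
  obtain ⟨ω₁, ω₂, h, rfl⟩ := hL
  refine ⟨⟨ω₁, ω₂, h⟩, ?_⟩
  ext z
  simp only [mem_ofPred_eq, SetLike.mem_coe, PeriodPair.mem_lattice, eq_comm]

lemma wzeta_eq (P : PeriodPair) (z : ℂ) :
    wzeta P.lattice z = 1 / z + zetaReg P z := by
  rw [wzeta, zetaReg]
  congr 1
  rw [tsum_subtype ((P.lattice : Set ℂ) \ {0})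
      (fun l : ℂ => 1 / (z - l) + 1 / l + z / l ^ 2)]
  refine Eq.trans ?_ (tsum_subtype (P.lattice : Set ℂ)
      (fun l : ℂ => if l = 0 then 0 else 1 / (z - l) + 1 / l + z / l ^ 2)).symm
  congr 1
  ext l
  by_cases h : l ∈ (P.lattice : Set ℂ) <;> by_cases h0 : l = 0 <;> simp [Set.indicator, h, h0]

lemma wzeta_summand_bound {r : ℝ} (hr : 0 < r) {s : ℂ} (hs : ‖s‖ < r) {l : ℂ}
    (h : 2 * r ≤ ‖l‖) :
    ‖1 / (s - l) + 1 / l + s / l ^ 2‖ ≤ 2 * r ^ 2 * ‖l‖ ^ (-3 : ℝ) := by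
  have hl : 0 < ‖l‖ := by linarith
  have hl0 : l ≠ 0 := norm_pos_iff.mp hl
  have hsl : s - l ≠ 0 := by
    rw [sub_ne_zero]; rintro rfl; linarith
  have hd : ‖l‖ / 2 ≤ ‖s - l‖ := by
    rw [norm_sub_rev]
    exact .trans (by linarith) (norm_sub_norm_le l s)
  calc
    _ = ‖s ^ 2 / ((s - l) * l ^ 2)‖ := by
      congr 1; field_simp; ring
    _ = ‖s‖ ^ 2 / (‖s - l‖ * ‖l‖ ^ 2) := by simp
    _ ≤ r ^ 2 / (‖l‖ / 2 * ‖l‖ ^ 2) := by gcongr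
    _ = 2 * r ^ 2 / ‖l‖ ^ 3 := by field_simp
    _ = _ := by norm_cast

lemma hasSumLocallyUniformly_zetaReg (P : PeriodPair) :
    HasSumLocallyUniformly
      (fun (l : P.lattice) (z : ℂ) =>
        if l.1 = 0 then 0 else (1 / (z - l) + 1 / l + z / (l : ℂ) ^ 2))
      (zetaReg P) := by
  refine P.hasSumLocallyUniformly_aux (u := (2 * · ^ 2 * ‖·‖ ^ (-3 : ℝ))) _
    (fun _ _ ↦ (ZLattice.summable_norm_rpow _ _ (by simp; norm_num)).mul_left _) fun r hr ↦
    Filter.eventually_atTop.mpr ⟨2 * r, ?_⟩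
  rintro _ h s hs l rfl
  split_ifs
  · simpa using! show 0 ≤ 2 * r ^ 2 * (‖(l : ℂ)‖ ^ 3)⁻¹ by positivity
  · exact wzeta_summand_bound hr hs h

lemma hasDerivAt_zetaReg_summand {l z : ℂ} (hz : l = 0 ∨ z ≠ l) :
    HasDerivAt (fun z => if l = 0 then 0 else (1 / (z - l) + 1 / l + z / l ^ 2))
      (-(if l = 0 then 0 else (1 / (z - l) ^ 2 - 1 / l ^ 2))) z := by
  split_ifs with h
  · simpa using hasDerivAt_const z (0 : ℂ)
  · have hzl : z - l ≠ 0 := sub_ne_zero.mpr (hz.resolve_left h)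
    have h1 : HasDerivAt (fun z => (z - l)⁻¹) (-1 / (z - l) ^ 2) z :=
      ((hasDerivAt_id z).sub_const l).inv hzl
    have h2 := (h1.add_const (1 / l)).add ((hasDerivAt_id z).div_const (l ^ 2))
    refine (h2.congr_deriv ?_).congr_of_eventuallyEq (.of_forall fun w => ?_)
    · ring
    · simp

lemma ne_of_mem_compl_lattice_diff {P : PeriodPair} {z : ℂ}
    (hz : z ∈ ((P.lattice : Set ℂ) \ {0})ᶜ) (l : P.lattice) : l.1 = 0 ∨ z ≠ l := by
  by_contra! h
  exact hz ⟨h.2 ▸ l.2, fun e => h.1 (h.2 ▸ e)⟩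

lemma differentiableOn_zetaReg (P : PeriodPair) :
    DifferentiableOn ℂ (zetaReg P) ((P.lattice : Set ℂ) \ {0})ᶜ :=
  (hasSumLocallyUniformly_zetaReg P).hasSumLocallyUniformlyOn.differentiableOn
    (.of_forall fun _ ↦ .fun_sum fun i _ ↦ fun _ hz =>
      (hasDerivAt_zetaReg_summand
        (ne_of_mem_compl_lattice_diff hz i)).differentiableAt.differentiableWithinAt)
    P.isOpen_compl_lattice_sdiff

lemma analyticAt_zetaReg {P : PeriodPair} {z : ℂ} (hz : z ∈ ((P.lattice : Set ℂ) \ {0})ᶜ) :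
    AnalyticAt ℂ (zetaReg P) z :=
  (differentiableOn_zetaReg P).analyticAt (P.isOpen_compl_lattice_sdiff.mem_nhds hz)

lemma deriv_zetaReg {P : PeriodPair} {z : ℂ} (hz : z ∈ ((P.lattice : Set ℂ) \ {0})ᶜ) :
    deriv (zetaReg P) z = -P.weierstrassPExcept 0 z := by
  have h1 := (hasSumLocallyUniformly_zetaReg P).tendstoLocallyUniformlyOn
    (s := ((P.lattice : Set ℂ) \ {0})ᶜ) |>.deriv
    (.of_forall fun s ↦ .fun_sum fun i _ ↦ fun _ hz => (hasDerivAt_zetaReg_summand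
        (ne_of_mem_compl_lattice_diff hz i)).differentiableAt.differentiableWithinAt)
    P.isOpen_compl_lattice_sdiff
  have h2 : HasSum
      (fun l : P.lattice => -(if l.1 = 0 then 0 else (1 / (z - l) ^ 2 - 1 / (l : ℂ) ^ 2)))
      (-P.weierstrassPExcept 0 z) := (P.hasSum_weierstrassPExcept 0 z).neg
  refine tendsto_nhds_unique (h1.tendsto_at hz) (h2.congr fun s => ?_)
  exact (HasDerivAt.fun_sum fun i _ => hasDerivAt_zetaReg_summand
    (ne_of_mem_compl_lattice_diff hz i)).deriv.symm

lemma notMem_lattice_diff {P : PeriodPair} {z : ℂ} (hz : z ∉ P.lattice) :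
    z ∈ ((P.lattice : Set ℂ) \ {0})ᶜ := fun h => hz h.1

lemma ne_zero_of_notMem_lattice {P : PeriodPair} {z : ℂ} (hz : z ∉ P.lattice) : z ≠ 0 :=
  fun h => hz (h ▸ P.lattice.zero_mem)

lemma analyticAt_wzeta {P : PeriodPair} {z : ℂ} (hz : z ∉ P.lattice) :
    AnalyticAt ℂ (wzeta P.lattice) z := by
  rw [funext (wzeta_eq P)]
  exact (analyticAt_const.div analyticAt_id (ne_zero_of_notMem_lattice hz)).add
    (analyticAt_zetaReg (notMem_lattice_diff hz))

lemma hasDerivAt_wzeta {P : PeriodPair} {z : ℂ} (hz : z ∉ P.lattice) :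
    HasDerivAt (wzeta P.lattice) (-P.weierstrassP z) z := by
  rw [funext (wzeta_eq P)]
  have h1 := (analyticAt_zetaReg (notMem_lattice_diff hz)).differentiableAt.hasDerivAt
  rw [deriv_zetaReg (notMem_lattice_diff hz)] at h1
  have h2 : HasDerivAt (fun z : ℂ => 1 / z) (-(z ^ 2)⁻¹) z := by
    simpa using hasDerivAt_inv (ne_zero_of_notMem_lattice hz)
  refine (h2.add h1).congr_deriv ?_
  have h3 := P.weierstrassPExcept_add 0 z
  simp only [ZeroMemClass.coe_zero] at h3
  rw [← h3]
  simp

lemma PeriodPair.isPreconnected_compl_lattice (P : PeriodPair) :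
    IsPreconnected (P.lattice : Set ℂ)ᶜ :=
  ((Set.countable_coe_iff.mp (P.latticeEquivProd.toEquiv.injective.countable)
    ).isConnected_compl_of_one_lt_rank (by simp)).isPreconnected

lemma exists_wzeta_add (P : PeriodPair) {l : ℂ} (hl : l ∈ P.lattice) :
    ∃ η : ℂ, ∀ z ∉ P.lattice, wzeta P.lattice (z + l) = wzeta P.lattice z + η := by
  have hmem : ∀ {z}, z ∉ P.lattice → z + l ∉ P.lattice := fun hz h =>
    hz ((Submodule.add_mem_iff_left _ hl).mp h)
  have hd : ∀ z ∉ P.lattice,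
      HasDerivAt (fun z => wzeta P.lattice (z + l) - wzeta P.lattice z) 0 z := fun z hz => by
    have h := ((hasDerivAt_wzeta (hmem hz)).comp_add_const z l).sub (hasDerivAt_wzeta hz)
    rwa [P.weierstrassP_add_coe z ⟨l, hl⟩, sub_self] at h
  have hP := P.isClosed_lattice.isOpen_compl
  refine ⟨wzeta P.lattice (P.ω₁ / 2 + l) - wzeta P.lattice (P.ω₁ / 2), fun z hz => ?_⟩
  have := hP.is_const_of_deriv_eq_zero P.isPreconnected_compl_lattice
    (fun w hw => (hd w hw).differentiableAt.differentiableWithinAt)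
    (fun w hw => (hd w hw).deriv) hz P.ω₁_div_two_notMem_lattice
  linear_combination this

lemma wzeta_neg (P : PeriodPair) (z : ℂ) : wzeta P.lattice (-z) = -wzeta P.lattice z := by
  rw [wzeta_eq, wzeta_eq, zetaReg, zetaReg, neg_add, ← tsum_neg, ← (Equiv.neg P.lattice).tsum_eq]
  congr 1
  · rw [div_neg]
  · congr with l
    by_cases h : (l : ℂ) = 0
    · simp [h]
    · have : -z - -(l : ℂ) = -(z - l) := by ring
      simp only [Equiv.neg_apply, NegMemClass.coe_neg, neg_eq_zero, h, if_false, this, div_neg,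
        even_two.neg_pow, neg_div]
      ring

lemma ExtAnalyticAt.of_comp_add {F : ℂ → ℂ} {x : ℂ}
    (h : ExtAnalyticAt (fun w => F (w + x)) 0) : ExtAnalyticAt F x := by
  obtain ⟨g, hg, he⟩ := h
  refine ⟨fun z => g (z - x), ?_, ?_⟩
  · have h1 : AnalyticAt ℂ (fun z : ℂ => z - x) x := by fun_prop
    exact AnalyticAt.fun_comp (by simpa using hg) h1
  · have ht : Tendsto (fun z : ℂ => z - x) (𝓝[≠] x) (𝓝[≠] 0) :=
      tendsto_nhdsWithin_of_tendsto_nhds_of_eventually_within _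
        ((Continuous.tendsto' (by fun_prop) _ _ (by simp)).mono_left nhdsWithin_le_nhds)
        (eventually_mem_nhdsWithin.mono fun z hz => by simpa [sub_eq_zero] using hz)
    exact (ht.eventually he).mono fun z hz => by simpa using hz

lemma exists_differentiable_of_extAnalyticAt {F : ℂ → ℂ} (hF : ∀ x, ExtAnalyticAt F x) :
    ∃ G : ℂ → ℂ, Differentiable ℂ G ∧ ∀ x, ∀ᶠ z in 𝓝[≠] x, F z = G z := by
  choose g hg he using hF
  have key : ∀ x, ∀ᶠ y in 𝓝 x, g y y = g x y := fun x => by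
    have h1 : ∀ᶠ y in 𝓝[≠] x, g y y = g x y := by
      have h2 := eventually_eventually_nhdsWithin.mpr (he x)
      have h3 := (hg x).eventually_analyticAt.filter_mono (nhdsWithin_le_nhds (s := {x}ᶜ))
      filter_upwards [h2, h3, eventually_mem_nhdsWithin] with y hy hy' hyx
      have h4 : ∀ᶠ z in 𝓝[≠] y, F z = g x z := by
        rw [nhdsWithin_eq_nhds.mpr (isOpen_compl_singleton.mem_nhds hyx)] at hy
        exact hy.filter_mono nhdsWithin_le_nhds
      have h5 : (fun z => g y z) =ᶠ[𝓝[≠] y] g x := by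
        filter_upwards [h4, he y] with z hz hz'
        rw [← hz, hz']
      exact tendsto_nhds_unique
        (((hg y).continuousAt.tendsto.mono_left nhdsWithin_le_nhds).congr' h5)
        (hy'.continuousAt.tendsto.mono_left nhdsWithin_le_nhds)
    rw [← nhdsNE_sup_pure]
    exact eventually_sup.mpr ⟨h1, by simp⟩
  refine ⟨fun x => g x x, fun x => ?_, fun x => ?_⟩
  · exact ((hg x).congr (EventuallyEq.symm (key x))).differentiableAt
  · filter_upwards [he x, (key x).filter_mono nhdsWithin_le_nhds] with z h1 h2
    rw [h1, h2]

lemma PeriodPair.exists_isCompact_sub_mem (P : PeriodPair) :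
    ∃ K : Set ℂ, IsCompact K ∧ ∀ z, ∃ l ∈ P.lattice, z - l ∈ K := by
  refine ⟨closure (ZSpan.fundamentalDomain P.basis),
    (ZSpan.fundamentalDomain_isBounded P.basis).isCompact_closure, fun z =>
    ⟨(ZSpan.floor P.basis z : ℂ), ?_, subset_closure (ZSpan.fract_mem_fundamentalDomain P.basis z)⟩⟩
  rw [P.lattice_eq_span_range_basis]
  exact (ZSpan.floor P.basis z).2

lemma PeriodPair.eventually_notMem_lattice (P : PeriodPair) (x : ℂ) :
    ∀ᶠ z in 𝓝[≠] x, z ∉ P.lattice := by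
  filter_upwards [nhdsWithin_le_nhds (P.compl_lattice_sdiff_singleton_mem_nhds x),
    eventually_mem_nhdsWithin] with z h1 h2 h3
  exact h1 ⟨h3, h2⟩

lemma extAnalyticAt_wzeta_mul {P : PeriodPair} {φ : ℂ → ℂ} (hφ : AnalyticAt ℂ φ 0)
    (h0 : φ 0 = 0) : ExtAnalyticAt (fun z => wzeta P.lattice z * φ z) 0 := by
  obtain ⟨p, hp⟩ := hφ
  refine ⟨fun z => dslope φ 0 z + zetaReg P z * φ z,
    (hp.has_fpower_series_dslope_fslope.analyticAt).add
      ((analyticAt_zetaReg (by simp)).mul ⟨p, hp⟩), ?_⟩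
  filter_upwards [eventually_mem_nhdsWithin] with z hz
  rw [wzeta_eq, dslope_of_ne _ hz, slope_def_field, h0]
  simp only [sub_zero]
  ring

lemma tendsto_mul_wzeta (P : PeriodPair) :
    Tendsto (fun z => z * wzeta P.lattice z) (𝓝[≠] 0) (𝓝 1) := by
  have h : Tendsto (fun z => 1 + z * zetaReg P z) (𝓝[≠] 0) (𝓝 (1 + 0 * zetaReg P 0)) :=
    (ContinuousAt.tendsto (continuousAt_const.add (continuousAt_id.mul
      (analyticAt_zetaReg (P := P) (by simp)).continuousAt))).mono_left nhdsWithin_le_nhds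
  simp only [zero_mul, add_zero] at h
  refine h.congr' ?_
  filter_upwards [eventually_mem_nhdsWithin] with z hz
  have : z ≠ 0 := hz
  rw [wzeta_eq]
  field_simp

lemma not_eventually_wzeta_eq_zero {P : PeriodPair} {a : ℂ} (ha : a ∉ P.lattice) :
    ¬ ∀ᶠ z in 𝓝 a, wzeta P.lattice z = 0 := by
  intro h
  have h1 := AnalyticOnNhd.eqOn_zero_of_preconnected_of_eventuallyEq_zero
    (f := wzeta P.lattice) (U := (P.lattice : Set ℂ)ᶜ)
    (fun z hz => analyticAt_wzeta hz) P.isPreconnected_compl_lattice ha h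
  have h2 : Tendsto (fun _ : ℂ => (0 : ℂ)) (𝓝[≠] 0) (𝓝 1) :=
    (tendsto_mul_wzeta P).congr' ((P.eventually_notMem_lattice 0).mono fun z hz => by
      simp only [h1 hz, Pi.zero_apply, mul_zero])
  exact zero_ne_one (tendsto_nhds_unique tendsto_const_nhds h2)

lemma Differentiable.eq_of_periodic {P : PeriodPair} {G : ℂ → ℂ} (hG : Differentiable ℂ G)
    (hper : ∀ l ∈ P.lattice, ∀ z, G (z + l) = G z) (z w : ℂ) : G z = G w := by
  obtain ⟨K, hK, hKz⟩ := P.exists_isCompact_sub_mem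
  refine hG.apply_eq_apply_of_bounded ((hK.image hG.continuous).isBounded.subset ?_) z w
  rintro _ ⟨u, rfl⟩
  obtain ⟨l, hl, hu⟩ := hKz u
  exact ⟨u - l, hu, by simpa using (hper l hl (u - l)).symm⟩

lemma tendsto_add_nhdsNE (x a : ℂ) : Tendsto (· + a) (𝓝[≠] x) (𝓝[≠] (x + a)) :=
  tendsto_nhdsWithin_of_tendsto_nhds_of_eventually_within _
    ((Continuous.tendsto' (by fun_prop) _ _ rfl).mono_left nhdsWithin_le_nhds)
    (eventually_mem_nhdsWithin.mono fun z hz => by simpa using hz)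

/-- The Weierstrass zeta function is not elliptic. -/
theorem not_periodic_wzeta (P : PeriodPair) :
    ¬ ∀ l ∈ P.lattice, ∀ z ∉ P.lattice, wzeta P.lattice (z + l) = wzeta P.lattice z := by
  intro hper
  have hadd : ∀ {z l}, l ∈ P.lattice → z ∉ P.lattice → z + l ∉ P.lattice := fun hl hz h =>
    hz ((Submodule.add_mem_iff_left _ hl).mp h)
  have hhalf : ∀ {w}, w ∉ P.lattice → w + w ∈ P.lattice → wzeta P.lattice w = 0 := by
    intro w hw hww
    have h1 := hper _ hww (-w) (by simpa using hw)
    rw [wzeta_neg, neg_add_cancel_left] at h1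
    linear_combination h1 / 2
  set a := P.ω₁ / 2 with ha
  set b := P.ω₂ / 2 with hb
  have ha' : a ∉ P.lattice := P.ω₁_div_two_notMem_lattice
  have hb' : b ∉ P.lattice := P.ω₂_div_two_notMem_lattice
  have haa : a + a ∈ P.lattice := by simpa [ha] using P.ω₁_mem_lattice
  have hbb : b + b ∈ P.lattice := by simpa [hb] using P.ω₂_mem_lattice
  have hba : b + a ∉ P.lattice := by
    have := (P.mul_ω₁_add_mul_ω₂_mem_lattice (α := 1 / 2) (β := 1 / 2)).not.mpr (by norm_num)
    convert this using 2
    simp only [ha, hb]; push_cast; ring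
  set F : ℂ → ℂ := fun z => wzeta P.lattice z * wzeta P.lattice (z + a) with hF
  have hdouble : ∀ {x l : ℂ}, l ∈ P.lattice → x + a = l → x + x ∈ P.lattice := by
    rintro x l hl rfl
    have := P.lattice.sub_mem (P.lattice.add_mem hl hl) haa
    convert this using 1; ring
  have hnot : ∀ {x}, x ∈ P.lattice → x + a ∉ P.lattice := fun hx => by
    rw [add_comm]; exact hadd hx ha'
  have han : ∀ {x w : ℂ}, x + w ∉ P.lattice →
      AnalyticAt ℂ (fun z => wzeta P.lattice (z + w)) x := fun h =>
    (analyticAt_wzeta h).fun_comp (f := fun z => z + _) (by fun_prop)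
  have hext : ∀ x, ExtAnalyticAt F x := by
    intro x
    by_cases hx : x ∈ P.lattice
    · obtain ⟨g, hg, he⟩ := extAnalyticAt_wzeta_mul (P := P)
        (han (x := 0) (w := x + a) (by simpa using hnot hx))
        (by
          rw [zero_add]
          refine hhalf (hnot hx) ?_
          convert P.lattice.add_mem (P.lattice.add_mem hx hx) haa using 1; ring)
      refine .of_comp_add ⟨g, hg, ?_⟩
      filter_upwards [he, P.eventually_notMem_lattice 0] with z hz hzl
      rw [← hz, hF]
      simp only [hper x hx z hzl, add_assoc]
    · by_cases hxa : x + a ∈ P.lattice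
      · obtain ⟨g, hg, he⟩ := extAnalyticAt_wzeta_mul (P := P)
          (han (x := 0) (w := x) (by simpa using hx))
          (by rw [zero_add]; exact hhalf hx (hdouble hxa rfl))
        refine .of_comp_add ⟨g, hg, ?_⟩
        filter_upwards [he, P.eventually_notMem_lattice 0] with z hz hzl
        rw [← hz, hF]
        simp only [add_assoc, hper (x + a) hxa z hzl, mul_comm]
      · exact ⟨F, (analyticAt_wzeta hx).mul (han hxa), .of_forall fun _ => rfl⟩
  obtain ⟨G, hG, hFG⟩ := exists_differentiable_of_extAnalyticAt hext
  have hGlim : ∀ x, Tendsto F (𝓝[≠] x) (𝓝 (G x)) := fun x =>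
    ((hG x).continuousAt.tendsto.mono_left nhdsWithin_le_nhds).congr'
      ((hFG x).mono fun z hz => hz.symm)
  have hGper : ∀ l ∈ P.lattice, ∀ z, G (z + l) = G z := by
    intro l hl z
    refine tendsto_nhds_unique (((hGlim (z + l)).comp (tendsto_add_nhdsNE z l)).congr' ?_) (hGlim z)
    filter_upwards [P.eventually_notMem_lattice z,
      (tendsto_add_nhdsNE z a).eventually (P.eventually_notMem_lattice (z + a))] with w hw hwa
    simp only [hF, Function.comp_apply, hper l hl w hw, add_right_comm w l a,
      hper l hl (w + a) hwa]
  have hGb : G b = 0 := by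
    have h1 : Tendsto F (𝓝[≠] b) (𝓝 (F b)) :=
      ((analyticAt_wzeta hb').mul (han hba)).continuousAt.tendsto.mono_left nhdsWithin_le_nhds
    rw [tendsto_nhds_unique (hGlim b) h1]
    simp only [hF, hhalf hb' hbb, zero_mul]
  have hG0 : ∀ z, G z = 0 := fun z => (hG.eq_of_periodic hGper z b).trans hGb
  have h2 : ∀ᶠ z in 𝓝[≠] (0 : ℂ), wzeta P.lattice (z + a) = 0 := by
    filter_upwards [hFG 0, (tendsto_mul_wzeta P).eventually_ne one_ne_zero] with z h1 h2
    rw [hG0 z] at h1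
    exact (mul_eq_zero.mp h1).resolve_left (right_ne_zero_of_mul h2)
  have h3 := (han (x := 0) (w := a) (by simpa using ha')).frequently_zero_iff_eventually_zero.mp
    h2.frequently
  refine not_eventually_wzeta_eq_zero ha' ?_
  have ht : Tendsto (fun z : ℂ => z - a) (𝓝 a) (𝓝 0) :=
    Continuous.tendsto' (by fun_prop) _ _ (by simp)
  exact (ht.eventually h3).mono fun z hz => by simpa using hz

/-- A set of exceptional points: invariant under the lattice, closed and discrete. -/
structure IsExceptional (P : PeriodPair) (B : Set ℂ) : Prop where
  add_mem : ∀ l ∈ P.lattice, ∀ z ∈ B, z + l ∈ B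
  eventually_notMem : ∀ x, ∀ᶠ z in 𝓝[≠] x, z ∉ B

namespace IsExceptional

variable {P : PeriodPair} {B B' : Set ℂ}

lemma add_notMem (h : IsExceptional P B) {l : ℂ} (hl : l ∈ P.lattice) {z : ℂ} (hz : z ∉ B) :
    z + l ∉ B := fun hzl =>
  hz (by simpa using h.add_mem (-l) (P.lattice.neg_mem hl) _ hzl)

lemma union (h : IsExceptional P B) (h' : IsExceptional P B') : IsExceptional P (B ∪ B') where
  add_mem l hl z hz := hz.imp (h.add_mem l hl z) (h'.add_mem l hl z)
  eventually_notMem x := by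
    filter_upwards [h.eventually_notMem x, h'.eventually_notMem x] with z h1 h2
    exact fun h => h.elim h1 h2

lemma preimage_add (h : IsExceptional P B) (a : ℂ) : IsExceptional P {z | z + a ∈ B} where
  add_mem l hl z hz := by
    have := h.add_mem l hl _ hz
    rwa [add_right_comm] at this
  eventually_notMem x := (tendsto_add_nhdsNE x a).eventually (h.eventually_notMem (x + a))

lemma empty : IsExceptional P ∅ := ⟨by simp, by simp⟩

lemma lattice : IsExceptional P (P.lattice : Set ℂ) :=
  ⟨fun _ hl _ hz => P.lattice.add_mem hz hl, P.eventually_notMem_lattice⟩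

end IsExceptional

lemma AnalyticAt.comp_add {f : ℂ → ℂ} {z a : ℂ} (h : AnalyticAt ℂ f (z + a)) :
    AnalyticAt ℂ (fun w => f (w + a)) z :=
  h.fun_comp (f := fun w => w + a) (by fun_prop)

lemma MeromorphicAt.comp_add {f : ℂ → ℂ} {z a : ℂ} (h : MeromorphicAt f (z + a)) :
    MeromorphicAt (fun w => f (w + a)) z :=
  h.comp_analyticAt (f := f) (g := fun w => w + a) (by fun_prop)

lemma isExceptional_not_analyticAt {P : PeriodPair} {f : ℂ → ℂ}
    (hf : IsElliptic P.lattice f) : IsExceptional P {z | ¬ AnalyticAt ℂ f z} where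
  add_mem l hl z hz h := hz <| by
    have h1 : AnalyticAt ℂ (fun w => f (w + l)) z := h.comp_add
    refine h1.congr ?_
    have h2 : ∀ᶠ w in 𝓝 z, AnalyticAt ℂ f (w + l) :=
      (Continuous.tendsto' (f := fun w : ℂ => w + l) (by fun_prop) z _ rfl).eventually
        h.eventually_analyticAt
    filter_upwards [h2] with w hw
    simpa using (hf.2 (-l) (P.lattice.neg_mem hl) _ hw).symm
  eventually_notMem x :=
    (hf.1 x (mem_univ x)).eventually_analyticAt.mono fun z hz => not_not.mpr hz

/-- A meromorphic function that is periodic away from an exceptional set. -/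
def IsAlmostElliptic (P : PeriodPair) (g : ℂ → ℂ) : Prop :=
  (∀ x, MeromorphicAt g x) ∧
    ∃ B, IsExceptional P B ∧ ∀ l ∈ P.lattice, ∀ z ∉ B, g (z + l) = g z

/-- Elliptic summability up to an exceptional set. -/
def AlmostSummable (P : PeriodPair) (s : ℂ) (F : ℂ → ℂ) : Prop :=
  ∃ g B, IsAlmostElliptic P g ∧ IsExceptional P B ∧ ∀ z ∉ B, F z = g (z + s) - g z

open Classical in
/-- Values of `g` on `B` can be altered so that no point of `B` remains a point of analyticity. -/
lemma exists_eqOn_compl_not_analyticAt {P : PeriodPair} {B : Set ℂ} (hB : IsExceptional P B)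
    (g : ℂ → ℂ) : ∃ g' : ℂ → ℂ, EqOn g' g Bᶜ ∧ ∀ z ∈ B, ¬ AnalyticAt ℂ g' z := by
  refine ⟨fun z => if z ∈ B then (if Tendsto g (𝓝[≠] z) (𝓝 0) then 1 else 0) else g z,
    fun z hz => if_neg hz, fun z hz h => ?_⟩
  have h1 := h.continuousAt.tendsto.mono_left (nhdsWithin_le_nhds (s := {z}ᶜ))
  rw [if_pos hz] at h1
  have h2 := h1.congr' ((hB.eventually_notMem z).mono fun w hw => if_neg hw)
  split_ifs at h2 with h3
  · exact one_ne_zero (tendsto_nhds_unique h2 h3)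
  · exact h3 h2

lemma IsAlmostElliptic.add {P : PeriodPair} {g g' : ℂ → ℂ} (h : IsAlmostElliptic P g)
    (h' : IsAlmostElliptic P g') : IsAlmostElliptic P (fun z => g z + g' z) := by
  obtain ⟨hm, B, hB, hp⟩ := h
  obtain ⟨hm', B', hB', hp'⟩ := h'
  refine ⟨fun x => (hm x).fun_add (hm' x), B ∪ B', hB.union hB', fun l hl z hz => ?_⟩
  beta_reduce
  rw [hp l hl z fun h => hz (.inl h), hp' l hl z fun h => hz (.inr h)]

lemma IsAlmostElliptic.const_mul {P : PeriodPair} {g : ℂ → ℂ} (h : IsAlmostElliptic P g) (a : ℂ) :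
    IsAlmostElliptic P (fun z => a * g z) := by
  obtain ⟨hm, B, hB, hp⟩ := h
  refine ⟨fun x => (MeromorphicAt.const a x).fun_mul (hm x), B, hB, fun l hl z hz => ?_⟩
  beta_reduce
  rw [hp l hl z hz]

lemma IsAlmostElliptic.comp_add {P : PeriodPair} {g : ℂ → ℂ} (h : IsAlmostElliptic P g) (a : ℂ) :
    IsAlmostElliptic P (fun z => g (z + a)) := by
  obtain ⟨hm, B, hB, hp⟩ := h
  refine ⟨fun x => (hm _).comp_add, _, hB.preimage_add a, fun l hl z hz => ?_⟩
  beta_reduce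
  rw [add_right_comm, hp l hl _ hz]

lemma IsAlmostElliptic.almostSummable {P : PeriodPair} {g : ℂ → ℂ} (h : IsAlmostElliptic P g)
    (s : ℂ) : AlmostSummable P s (fun z => g (z + s) - g z) :=
  ⟨g, ∅, h, .empty, fun _ _ => rfl⟩

namespace AlmostSummable

variable {P : PeriodPair} {s : ℂ} {F F' : ℂ → ℂ}

lemma ellSummable (h : AlmostSummable P s F) : EllSummable P.lattice s F := by
  obtain ⟨g, B, ⟨hm, B', hB', hp⟩, hB, hF⟩ := h
  have hU := hB.union hB'
  obtain ⟨g', hg', hna⟩ := exists_eqOn_compl_not_analyticAt hU g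
  have hout : ∀ z, AnalyticAt ℂ g' z → z ∉ B ∪ B' := fun z hz hzB => hna z hzB hz
  refine ⟨g', ⟨fun x _ => ?_, fun l hl z hz => ?_⟩, fun z hz hzs => ?_⟩
  · exact (hm x).congr ((hU.eventually_notMem x).mono fun z hz => (hg' hz).symm)
  · rw [hg' (hU.add_notMem hl (hout z hz)), hg' (hout z hz)]
    exact hp l hl z fun h => hout z hz (.inr h)
  · rw [hg' (hout _ hz), hg' (hout _ hzs)]
    exact hF z fun h => hout z hz (.inl h)

lemma congr (h : AlmostSummable P s F) {B : Set ℂ} (hB : IsExceptional P B)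
    (hF : ∀ z ∉ B, F' z = F z) : AlmostSummable P s F' := by
  obtain ⟨g, B', hg, hB', hgF⟩ := h
  refine ⟨g, B ∪ B', hg, hB.union hB', fun z hz => ?_⟩
  rw [hF z fun h => hz (.inl h), hgF z fun h => hz (.inr h)]

lemma add (h : AlmostSummable P s F) (h' : AlmostSummable P s F') :
    AlmostSummable P s (fun z => F z + F' z) := by
  obtain ⟨g, B, hg, hB, hF⟩ := h
  obtain ⟨g', B', hg', hB', hF'⟩ := h'
  refine ⟨_, B ∪ B', hg.add hg', hB.union hB', fun z hz => ?_⟩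
  beta_reduce
  rw [hF z fun h => hz (.inl h), hF' z fun h => hz (.inr h)]
  ring

lemma const_mul (h : AlmostSummable P s F) (a : ℂ) : AlmostSummable P s (fun z => a * F z) := by
  obtain ⟨g, B, hg, hB, hF⟩ := h
  refine ⟨_, B, hg.const_mul a, hB, fun z hz => ?_⟩
  beta_reduce
  rw [hF z hz]
  ring

lemma zero (P : PeriodPair) (s : ℂ) : AlmostSummable P s (fun _ => 0) :=
  ⟨0, ∅, ⟨fun x => MeromorphicAt.const 0 x, ∅, .empty, by simp⟩, .empty, by simp⟩

lemma sum {ι : Type*} (t : Finset ι) {F : ι → ℂ → ℂ} (h : ∀ i ∈ t, AlmostSummable P s (F i)) :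
    AlmostSummable P s (fun z => ∑ i ∈ t, F i z) := by
  classical
  induction t using Finset.induction_on with
  | empty => simpa using zero P s
  | insert i t hi ih =>
    simp only [Finset.sum_insert hi]
    exact (h i (Finset.mem_insert_self i t)).add
      (ih fun j hj => h j (Finset.mem_insert_of_mem hj))

lemma of_int_steps {H : ℤ → ℂ → ℂ} (h0 : AlmostSummable P s (H 0))
    (hstep : ∀ n, AlmostSummable P s (fun z => H (n + 1) z - H n z)) (n : ℤ) :
    AlmostSummable P s (H n) := by
  induction n using Int.induction_on with
  | zero => exact h0
  | succ n ih =>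
    refine (ih.add (hstep n)).congr .empty fun z _ => ?_
    ring
  | pred n ih =>
    refine (ih.add ((hstep (-n - 1)).const_mul (-1))).congr .empty fun z _ => ?_
    rw [sub_add_cancel]
    ring

end AlmostSummable

lemma IsAlmostElliptic.almostSummable_sub_translate {P : PeriodPair} {g : ℂ → ℂ}
    (h : IsAlmostElliptic P g) (s r : ℂ) (n : ℤ) :
    AlmostSummable P s (fun z => g (z - r) - g (z - r - n * s)) := by
  refine AlmostSummable.of_int_steps
    (H := fun (n : ℤ) z => g (z - r) - g (z - r - n * s)) ?_ (fun n => ?_) n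
  · simpa using AlmostSummable.zero P s
  · refine ((h.comp_add (-r - (n + 1) * s)).almostSummable s).congr .empty fun z _ => ?_
    push_cast
    have h1 : z + s + (-r - (n + 1) * s) = z - r - n * s := by ring
    have h2 : z + (-r - (n + 1) * s) = z - r - (n + 1) * s := by ring
    rw [h1, h2]
    ring

lemma meromorphicAt_wzeta (P : PeriodPair) (x : ℂ) : MeromorphicAt (wzeta P.lattice) x := by
  by_cases hx : x ∈ P.lattice
  · obtain ⟨η, hη⟩ := exists_wzeta_add P hx
    have h0 : MeromorphicAt (wzeta P.lattice) (x + -x) := by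
      rw [add_neg_cancel, funext (wzeta_eq P)]
      exact ((MeromorphicAt.const 1 _).fun_div (MeromorphicAt.id _)).fun_add
        (analyticAt_zetaReg (by simp)).meromorphicAt
    refine (h0.comp_add.fun_add (MeromorphicAt.const η x)).congr ?_
    filter_upwards [P.eventually_notMem_lattice x] with z hz
    have := hη (z + -x) (IsExceptional.lattice.add_notMem (P.lattice.neg_mem hx) hz)
    rw [← this, neg_add_cancel_right]
  · exact (analyticAt_wzeta hx).meromorphicAt

lemma isAlmostElliptic_wzeta_sub (P : PeriodPair) (a b : ℂ) :
    IsAlmostElliptic P (fun z => wzeta P.lattice (z + a) - wzeta P.lattice (z + b)) := by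
  refine ⟨fun x => (meromorphicAt_wzeta P _).comp_add.fun_sub (meromorphicAt_wzeta P _).comp_add,
    _, (IsExceptional.lattice.preimage_add a).union (IsExceptional.lattice.preimage_add b),
    fun l hl z hz => ?_⟩
  obtain ⟨η, hη⟩ := exists_wzeta_add P hl
  beta_reduce
  rw [add_right_comm z l a, add_right_comm z l b, hη _ fun h => hz (.inl h),
    hη _ fun h => hz (.inr h)]
  ring

lemma iteratedDeriv_wzeta_add {P : PeriodPair} {m : ℕ} (hm : m ≠ 0) {l : ℂ} (hl : l ∈ P.lattice)
    {z : ℂ} (hz : z ∉ P.lattice) :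
    iteratedDeriv m (wzeta P.lattice) (z + l) = iteratedDeriv m (wzeta P.lattice) z := by
  obtain ⟨η, hη⟩ := exists_wzeta_add P hl
  have h1 : (fun w => wzeta P.lattice (w + l)) =ᶠ[𝓝 z] fun w => η + wzeta P.lattice w := by
    filter_upwards [P.isClosed_lattice.isOpen_compl.mem_nhds hz] with w hw
    rw [hη w hw, add_comm]
  have h2 := h1.iteratedDeriv_eq m
  rw [iteratedDeriv_comp_add_const] at h2
  beta_reduce at h2
  rw [h2, iteratedDeriv_const_add (Nat.pos_of_ne_zero hm)]

lemma isAlmostElliptic_iteratedDeriv_wzeta (P : PeriodPair) {m : ℕ} (hm : m ≠ 0) :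
    IsAlmostElliptic P (iteratedDeriv m (wzeta P.lattice)) := by
  refine ⟨fun x => ?_, _, .lattice, fun l hl z hz => iteratedDeriv_wzeta_add hm hl hz⟩
  clear hm
  induction m with
  | zero => simpa using meromorphicAt_wzeta P x
  | succ m ih =>
    rw [iteratedDeriv_succ]
    exact ih.deriv

lemma almostSummable_wzeta_sub (P : PeriodPair) (s r : ℂ) (n : ℤ) :
    AlmostSummable P s (fun z => wzeta P.lattice (z - r) - wzeta P.lattice (z - r - n * s)
      + n * (wzeta P.lattice (z - s) - wzeta P.lattice z)) := by
  refine AlmostSummable.of_int_steps (H := fun (n : ℤ) z => wzeta P.lattice (z - r) -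
    wzeta P.lattice (z - r - n * s) + n * (wzeta P.lattice (z - s) - wzeta P.lattice z))
    ?_ (fun n => ?_) n
  · simpa using AlmostSummable.zero P s
  · refine ((isAlmostElliptic_wzeta_sub P (-r - (n + 1) * s) (-s)).almostSummable s).congr
      .empty fun z _ => ?_
    push_cast
    have h1 : z + s + (-r - (n + 1) * s) = z - r - n * s := by ring
    have h2 : z + (-r - (n + 1) * s) = z - r - (n + 1) * s := by ring
    rw [h1, h2, add_neg_cancel_right, ← sub_eq_add_neg z]
    ring

lemma IsPrincPart.eq_zero_of_analyticAt {f : ℂ → ℂ} {α : ℂ} {c : ℕ → ℂ}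
    (hc : IsPrincPart f α c) (hf : AnalyticAt ℂ f α) : c = 0 := by
  obtain ⟨h0, hfin, g, hg, he⟩ := hc
  by_contra hne
  have hS : hfin.toFinset.Nonempty := by
    rw [hfin.toFinset_nonempty]
    exact Function.support_nonempty_iff.mpr hne
  set M := hfin.toFinset.max' hS with hM
  have hcM : c M ≠ 0 := by simpa using hfin.toFinset.max'_mem hS
  have hM0 : M ≠ 0 := fun h => hcM (h ▸ h0)
  have hle : ∀ k ∈ hfin.toFinset, k ≤ M := fun k hk => hfin.toFinset.le_max' k hk
  have h1 : Tendsto (fun z => (z - α) ^ M * (f z - g z)) (𝓝[≠] α) (𝓝 0) := by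
    have : ContinuousAt (fun z => (z - α) ^ M * (f z - g z)) α :=
      ((continuousAt_id.sub continuousAt_const).pow M).mul (hf.continuousAt.sub hg.continuousAt)
    simpa [hM0] using this.tendsto.mono_left nhdsWithin_le_nhds
  have h2 : Tendsto (fun z => ∑ k ∈ hfin.toFinset, c k * (z - α) ^ (M - k)) (𝓝[≠] α)
      (𝓝 (c M)) := by
    have : Continuous (fun z => ∑ k ∈ hfin.toFinset, c k * (z - α) ^ (M - k)) := by fun_prop
    convert (this.tendsto α).mono_left nhdsWithin_le_nhds using 2
    rw [Finset.sum_eq_single M]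
    · simp
    · intro k hk hkM
      have : M - k ≠ 0 := by have := hle k hk; omega
      simp [this]
    · intro h
      exact absurd (hfin.toFinset.max'_mem hS) h
  refine hcM (tendsto_nhds_unique (h2.congr' ?_) h1)
  filter_upwards [he, eventually_mem_nhdsWithin] with z hz hzα
  have hzα' : z - α ≠ 0 := sub_ne_zero.mpr hzα
  rw [← hz, sub_sub_cancel, finsum_eq_sum_of_support_subset (s := hfin.toFinset), Finset.mul_sum]
  · refine Finset.sum_congr rfl fun k hk => ?_
    rw [← pow_sub_mul_pow _ (hle k hk)]
    field_simp
  · intro k hk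
    have : c k ≠ 0 := fun h => hk (by simp [h])
    simpa using this

lemma IsExceptional.finite_inter {P : PeriodPair} {B K : Set ℂ} (hB : IsExceptional P B)
    (hK : IsCompact K) : (B ∩ K).Finite := by
  by_contra h
  obtain ⟨x, -, hx⟩ := Set.Infinite.exists_accPt_of_subset_isCompact h hK inter_subset_right
  obtain ⟨z, hz, hzB⟩ := ((accPt_iff_frequently_nhdsNE.mp hx).and_eventually
    (hB.eventually_notMem x)).exists
  exact hzB hz.1

lemma finite_poles_of_isPinning {P : PeriodPair} {s : ℂ} {R B : Set ℂ}
    (hR : IsPinning P.lattice s R) (hB : IsExceptional P B) :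
    {p : ℂ × ℤ | p.1 ∈ R ∧ p.1 + p.2 * s ∈ B}.Finite := by
  obtain ⟨K, hK, hKz⟩ := P.exists_isCompact_sub_mem
  choose l hl hlK using hKz
  refine Set.Finite.of_finite_image (f := fun p : ℂ × ℤ => p.1 + p.2 * s - l (p.1 + p.2 * s))
    ((hB.finite_inter hK).subset ?_) ?_
  · rintro _ ⟨p, hp, rfl⟩
    refine ⟨?_, hlK _⟩
    simpa [sub_eq_add_neg] using hB.add_mem _ (P.lattice.neg_mem (hl (p.1 + p.2 * s))) _ hp.2
  · rintro p hp q hq hpq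
    have h1 := (hR (p.1 + p.2 * s - l (p.1 + p.2 * s))).unique
      (y₁ := (p.1, p.2, -l (p.1 + p.2 * s))) (y₂ := (q.1, q.2, -l (q.1 + q.2 * s)))
      ⟨hp.1, P.lattice.neg_mem (hl _), sub_eq_add_neg _ _⟩
      ⟨hq.1, P.lattice.neg_mem (hl _), hpq.trans (sub_eq_add_neg _ _)⟩
    simp only [Prod.mk.injEq] at h1
    exact Prod.ext h1.1 h1.2.1

/-- Finite index sets carrying all principal part coefficients along the orbits of a pinning. -/
lemma exists_finset_support {P : PeriodPair} {s : ℂ} {R : Set ℂ} (hR : IsPinning P.lattice s R)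
    {f : ℂ → ℂ} (hf : IsElliptic P.lattice f) {c : ℂ → ℕ → ℂ}
    (hc : ∀ α : ℂ, IsPrincPart f α (c α)) :
    ∃ (T : Finset ℂ) (N : Finset ℤ) (K : Finset ℕ), (T : Set ℂ) ⊆ R ∧ 1 ∈ K ∧
      (∀ r ∈ R, r ∉ T → ∀ n : ℤ, c (r + n * s) = 0) ∧
      (∀ r ∈ R, ∀ n : ℤ, n ∉ N → c (r + n * s) = 0) ∧
      (∀ r ∈ R, ∀ n : ℤ, ∀ k, k ∉ K → c (r + n * s) k = 0) := by
  classical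
  have hfin := finite_poles_of_isPinning hR (isExceptional_not_analyticAt hf)
  have hmem : ∀ r ∈ R, ∀ n : ℤ, c (r + n * s) ≠ 0 → (r, n) ∈ hfin.toFinset := fun r hr n h => by
    rw [hfin.mem_toFinset]
    exact ⟨hr, fun ha => h ((hc _).eq_zero_of_analyticAt ha)⟩
  refine ⟨hfin.toFinset.image Prod.fst, hfin.toFinset.image Prod.snd,
    insert 1 (hfin.toFinset.biUnion fun p => (hc (p.1 + p.2 * s)).2.1.toFinset),
    ?_, Finset.mem_insert_self _ _, fun r hr hT n => ?_, fun r hr n hN => ?_,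
    fun r hr n k hk => ?_⟩
  · intro r hr
    obtain ⟨p, hp, rfl⟩ := Finset.mem_image.mp (Finset.mem_coe.mp hr)
    exact (hfin.mem_toFinset.mp hp).1
  · by_contra h
    exact hT (Finset.mem_image_of_mem Prod.fst (hmem r hr n h))
  · by_contra h
    exact hN (Finset.mem_image_of_mem Prod.snd (hmem r hr n h))
  · by_contra h
    refine hk (Finset.mem_insert_of_mem (Finset.mem_biUnion.mpr ⟨(r, n), hmem r hr n ?_, ?_⟩))
    · exact fun h0 => h (by rw [h0]; rfl)
    · simpa using h

lemma finsum_mem_eq_sum_of_eq_zero {R : Set ℂ} {T : Finset ℂ} (hT : (T : Set ℂ) ⊆ R) {φ : ℂ → ℂ}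
    (h : ∀ r ∈ R, r ∉ T → φ r = 0) : ∑ᶠ r ∈ R, φ r = ∑ r ∈ T, φ r := by
  refine finsum_mem_eq_sum_of_inter_support_eq _ (Set.ext fun r => ⟨fun hr => ⟨?_, hr.2⟩,
    fun hr => ⟨hT hr.1, hr.2⟩⟩)
  by_contra hrT
  exact hr.2 (h r hr.1 hrT)

lemma finsum_eq_sum_of_eq_zero {ι : Type*} {N : Finset ι} {φ : ι → ℂ}
    (h : ∀ n ∉ N, φ n = 0) : ∑ᶠ n, φ n = ∑ n ∈ N, φ n :=
  finsum_eq_sum_of_support_subset _ fun n hn => by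
    by_contra hnN
    exact hn (h n hnN)

/-- The summand of the zeta expansion with pole of order `k` at `0`. -/
noncomputable def zetaTerm (P : PeriodPair) (k : ℕ) (z : ℂ) : ℂ :=
  ((-1 : ℂ) ^ (k - 1) / (Nat.factorial (k - 1) : ℂ)) * iteratedDeriv (k - 1) (wzeta P.lattice) z

lemma zetaTerm_one (P : PeriodPair) : zetaTerm P 1 = wzeta P.lattice := by
  ext z
  simp [zetaTerm]

lemma isAlmostElliptic_zetaTerm (P : PeriodPair) {k : ℕ} (hk : 2 ≤ k) :
    IsAlmostElliptic P (zetaTerm P k) :=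
  (isAlmostElliptic_iteratedDeriv_wzeta P (by omega)).const_mul _

/-- The residues in the zeta expansion of an elliptic function add up to zero. -/
lemma sum_residues_eq_zero {P : PeriodPair} {f : ℂ → ℂ} (hf : IsElliptic P.lattice f) {c₀ : ℂ}
    {ι : Type*} (I : Finset ι) (p : ι → ℂ) (K : Finset ℕ) (h1K : 1 ∈ K) (C : ι → ℕ → ℂ)
    (hC : ∀ i ∈ I, C i 0 = 0)
    (hexp : ∀ z, AnalyticAt ℂ f z →
      f z = c₀ + ∑ i ∈ I, ∑ k ∈ K, C i k * zetaTerm P k (z - p i)) :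
    ∑ i ∈ I, C i 1 = 0 := by
  by_contra hρ
  refine not_periodic_wzeta P fun l hl => ?_
  obtain ⟨η, hη⟩ := exists_wzeta_add P hl
  suffices η = 0 by
    intro z hz
    rw [hη z hz, this, add_zero]
  have hA := isExceptional_not_analyticAt hf
  have hev : ∀ᶠ z in 𝓝[≠] (0 : ℂ), ∀ i ∈ I, z + -p i ∉ P.lattice :=
    (Filter.eventually_all_finset I).mpr fun i _ =>
      (IsExceptional.lattice.preimage_add (-p i)).eventually_notMem 0
  obtain ⟨z, hz, hzp⟩ := ((hA.eventually_notMem 0).and hev).exists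
  have hzl := hA.add_notMem hl hz
  have e1 := hexp z (not_not.mp hz)
  have e2 := hexp (z + l) (not_not.mp hzl)
  rw [hf.2 l hl z (not_not.mp hz), e1, add_right_inj] at e2
  have e3 : ∀ i ∈ I, ∑ k ∈ K, C i k * zetaTerm P k (z + l - p i) =
      ∑ k ∈ K, C i k * zetaTerm P k (z - p i) + C i 1 * η := by
    intro i hi
    have e4 : C i 1 * η = ∑ k ∈ K, if k = 1 then C i k * η else 0 := by
      rw [Finset.sum_ite_eq' K 1, if_pos h1K]
    rw [e4, ← Finset.sum_add_distrib]
    refine Finset.sum_congr rfl fun k _ => ?_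
    have hzi : z - p i ∉ P.lattice := hzp i hi
    rw [add_sub_right_comm]
    split_ifs with hk
    · rw [hk, zetaTerm_one, hη _ hzi]
      ring
    · rcases Nat.eq_zero_or_pos k with rfl | hk0
      · simp [hC i hi]
      · rw [zetaTerm, zetaTerm, iteratedDeriv_wzeta_add (by omega) hl hzi, add_zero]
  rw [Finset.sum_congr rfl e3, Finset.sum_add_distrib, ← Finset.sum_mul] at e2
  exact (mul_eq_zero.mp (left_eq_add.mp e2)).resolve_left hρ

/-- The contribution of one principal part coefficient to the difference between a function and
its reduced form. -/
lemma almostSummable_reduction_term (P : PeriodPair) (s r : ℂ) (n : ℤ) {k : ℕ} (hk : k ≠ 0) :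
    AlmostSummable P s (fun z => zetaTerm P k (z - r) - zetaTerm P k (z - r - n * s) +
      if k = 1 then n * (wzeta P.lattice (z - s) - wzeta P.lattice z) else 0) := by
  split_ifs with h
  · subst h
    rw [zetaTerm_one]
    exact almostSummable_wzeta_sub P s r n
  · simp only [add_zero]
    exact (isAlmostElliptic_zetaTerm P (by omega)).almostSummable_sub_translate s r n

theorem stmt3 (L : Set ℂ) (hL : IsLattice L) (s : ℂ)
    (hs : ∀ n : ℕ, 1 ≤ n → (n : ℂ) * s ∉ L)
    (R : Set ℂ) (hR : IsPinning L s R)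
    (f : ℂ → ℂ) (hf : IsElliptic L f)
    (c : ℂ → ℕ → ℂ) (hc : ∀ α : ℂ, IsPrincPart f α (c α))
    (c₀ : ℂ)
    (hc₀ : ∀ z : ℂ, AnalyticAt ℂ f z →
      f z = c₀ + ∑ᶠ r ∈ R, ∑ᶠ n : ℤ, ∑ᶠ k : ℕ,
        ((-1 : ℂ) ^ (k - 1) * c (r + (n : ℂ) * s) k / (Nat.factorial (k - 1) : ℂ)) *
          iteratedDeriv (k - 1) (wzeta L) (z - r - (n : ℂ) * s)) :
    EllSummable L s (fun z =>
      (c₀ + (∑ᶠ r ∈ R, ∑ᶠ n : ℤ, (n : ℂ) * c (r + (n : ℂ) * s) 1) *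
          (wzeta L (z - s) - wzeta L z)
        + ∑ᶠ r ∈ R, ∑ᶠ k : ℕ, (∑ᶠ n : ℤ, c (r + (n : ℂ) * s) k) *
            (if k = 1 then wzeta L (z - r) - wzeta L z
             else ((-1 : ℂ) ^ (k - 1) / (Nat.factorial (k - 1) : ℂ)) *
               iteratedDeriv (k - 1) (wzeta L) (z - r)))
      - f z) := by
  obtain ⟨P, rfl⟩ := hL.exists_periodPair
  obtain ⟨T, N, K, hTR, h1K, hT, hN, hK⟩ := exists_finset_support hR hf hc
  have hexp : ∀ z, AnalyticAt ℂ f z → f z = c₀ + ∑ r ∈ T, ∑ n ∈ N, ∑ k ∈ K,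
      c (r + n * s) k * zetaTerm P k (z - r - n * s) := by
    intro z hz
    rw [hc₀ z hz, finsum_mem_eq_sum_of_eq_zero hTR fun r hr hrT => by simp [hT r hr hrT]]
    congr 1
    refine Finset.sum_congr rfl fun r hr => ?_
    rw [finsum_eq_sum_of_eq_zero fun n hn => by simp [hN r (hTR hr) n hn]]
    refine Finset.sum_congr rfl fun n _ => ?_
    rw [finsum_eq_sum_of_eq_zero fun k hk => by simp [hK r (hTR hr) n k hk]]
    refine Finset.sum_congr rfl fun k _ => ?_
    rw [zetaTerm]
    ring
  have hpano : (∑ᶠ r ∈ R, ∑ᶠ n : ℤ, (n : ℂ) * c (r + (n : ℂ) * s) 1) =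
      ∑ r ∈ T, ∑ n ∈ N, (n : ℂ) * c (r + n * s) 1 := by
    rw [finsum_mem_eq_sum_of_eq_zero hTR fun r hr hrT => by simp [hT r hr hrT]]
    refine Finset.sum_congr rfl fun r hr => ?_
    rw [finsum_eq_sum_of_eq_zero fun n hn => by simp [hN r (hTR hr) n hn]]
  have hred : ∀ z, (∑ᶠ r ∈ R, ∑ᶠ k : ℕ, (∑ᶠ n : ℤ, c (r + (n : ℂ) * s) k) *
      (if k = 1 then wzeta P.lattice (z - r) - wzeta P.lattice z
        else ((-1 : ℂ) ^ (k - 1) / (Nat.factorial (k - 1) : ℂ)) *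
          iteratedDeriv (k - 1) (wzeta P.lattice) (z - r))) =
      ∑ r ∈ T, ∑ n ∈ N, ∑ k ∈ K, c (r + n * s) k *
        (zetaTerm P k (z - r) - if k = 1 then wzeta P.lattice z else 0) := by
    intro z
    rw [finsum_mem_eq_sum_of_eq_zero hTR fun r hr hrT => by simp [hT r hr hrT]]
    refine Finset.sum_congr rfl fun r hr => ?_
    rw [finsum_eq_sum_of_eq_zero fun k hk => by simp [hK r (hTR hr) _ k hk], Finset.sum_comm]
    refine Finset.sum_congr rfl fun k _ => ?_
    rw [finsum_eq_sum_of_eq_zero fun n hn => by simp [hN r (hTR hr) n hn], Finset.sum_mul]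
    refine Finset.sum_congr rfl fun n _ => ?_
    split_ifs with hk
    · rw [hk, zetaTerm_one]
    · rw [zetaTerm, sub_zero]
  have hres : ∑ r ∈ T, ∑ n ∈ N, c (r + n * s) 1 = 0 := by
    rw [← Finset.sum_product' T N fun r n => c (r + n * s) 1]
    refine sum_residues_eq_zero hf (c₀ := c₀) (T ×ˢ N) (fun i => i.1 + i.2 * s) K h1K
      (fun i k => c (i.1 + i.2 * s) k) (fun i _ => (hc _).1) fun z hz => ?_
    rw [hexp z hz, Finset.sum_product]
    simp only [sub_sub]
  have hsum : AlmostSummable P s (fun z => ∑ r ∈ T, ∑ n ∈ N, ∑ k ∈ K, c (r + n * s) k *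
      (zetaTerm P k (z - r) - zetaTerm P k (z - r - n * s) +
        if k = 1 then n * (wzeta P.lattice (z - s) - wzeta P.lattice z) else 0)) := by
    refine .sum T fun r _ => .sum N fun n _ => .sum K fun k _ => ?_
    rcases eq_or_ne k 0 with rfl | hk
    · simpa [(hc _).1] using AlmostSummable.zero P s
    · exact (almostSummable_reduction_term P s r n hk).const_mul _
  refine (hsum.congr (isExceptional_not_analyticAt hf) fun z hz => ?_).ellSummable
  rw [hexp z (not_not.mp hz), hpano, hred]
  have hpick : ∀ φ : ℂ → ℤ → ℂ, ∑ r ∈ T, ∑ n ∈ N, ∑ k ∈ K, (if k = 1 then φ r n else 0) =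
      ∑ r ∈ T, ∑ n ∈ N, φ r n := fun φ => by
    simp only [Finset.sum_ite_eq', h1K, if_true]
  have hsplit : ∀ r (n : ℤ) k, c (r + n * s) k *
      (zetaTerm P k (z - r) - zetaTerm P k (z - r - n * s) +
        if k = 1 then n * (wzeta P.lattice (z - s) - wzeta P.lattice z) else 0) =
      c (r + n * s) k * (zetaTerm P k (z - r) - if k = 1 then wzeta P.lattice z else 0) -
      c (r + n * s) k * zetaTerm P k (z - r - n * s) +
      ((if k = 1 then n * c (r + n * s) 1 * (wzeta P.lattice (z - s) - wzeta P.lattice z) else 0) +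
      if k = 1 then c (r + n * s) 1 * wzeta P.lattice z else 0) := by
    intro r n k
    split_ifs with hk
    · subst hk
      ring
    · ring
  simp only [hsplit, Finset.sum_add_distrib, Finset.sum_sub_distrib, hpick, ← Finset.sum_mul, hres]
  ring
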